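/- arXiv:2406.14785 — 7 statements merged into one kernel-verified Lean document; each statement's English description precedes it below -/
import Mathlib

section
/- Let n ≥ 2, let S, R, A be pairwise disjoint subsets of the token set Fin n, and let D ⊆ S × R × A be a finite set of knowledge triples such that: (i) for each pair (s,r) there is at most one a with (s,r,a) ∈ D; (ii) for each fixed subject s, distinct triples of D with subject s have distinct answers; (iii) for each fixed relation r, distinct triples of D with relation r have distinct answers; (iv) for each (s,r,a) ∈ D, a is the unique token appearing in D both as the answer of some triple with subject s and as the answer of some triple with relation r. Define the value matrix V = ∑_{(s,r,a)∈D} e_a (e_s + e_r)^T and key-query matrix W = 0. Then the one-layer transformer (V, W) answers every triple of D correctly under argmax decoding: for every (s,r,a) ∈ D and every token t ≠ a, Z(s,r)_a > Z(s,r)_t, where Z(s,r) = (1/2) V e_s + (1/2) V e_r. -/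
/-- The softmax function: `σ(x)_i = exp(x_i) / ∑_j exp(x_j)`. -/
noncomputable def softmax {d : ℕ} (x : Fin d → ℝ) : Fin d → ℝ :=
  fun i => Real.exp (x i) / ∑ j, Real.exp (x j)

/-- The standard basis vector `e_t ∈ ℝ^n`. -/
def e (n : ℕ) (t : Fin n) : Fin n → ℝ := Pi.single t 1

/-- Matrix-vector product `V x`. -/
def mv {n : ℕ} (V : Fin n → Fin n → ℝ) (x : Fin n → ℝ) : Fin n → ℝ :=
  fun i => ∑ j, V i j * x j

/-- Dot product of two vectors. -/
def dot {n : ℕ} (u w : Fin n → ℝ) : ℝ := ∑ i, u i * w i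

/-- Outer product `u v^T`. -/
def outer {n : ℕ} (u w : Fin n → ℝ) : Fin n → Fin n → ℝ := fun i j => u i * w j

/-- Attention weights of the one-layer transformer with key-query matrix `W` on input `(s, r)`:
`σ((e_s^T W e_r, e_r^T W e_r))`; component `0` is the attention on the subject token `s`,
component `1` the attention on the relation/prompt token `r`. -/
noncomputable def att {n : ℕ} (W : Fin n → Fin n → ℝ) (s r : Fin n) : Fin 2 → ℝ :=
  softmax ![mv W (e n r) s, mv W (e n r) r]

/-- Pre-softmax output `Z(s,r) = Att_s • (V e_s) + Att_r • (V e_r)` of the one-layer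
transformer with value matrix `V` and key-query matrix `W`. -/
noncomputable def Zout {n : ℕ} (V W : Fin n → Fin n → ℝ) (s r : Fin n) : Fin n → ℝ :=
  att W s r 0 • mv V (e n s) + att W s r 1 • mv V (e n r)

/-- Model output `f(s,r) = σ(Z(s,r))`. -/
noncomputable def outF {n : ℕ} (V W : Fin n → Fin n → ℝ) (s r : Fin n) : Fin n → ℝ :=
  softmax (Zout V W s r)

/-- With the memorizing value matrix
`V = ∑_{(s,r,a) ∈ D} e_a (e_s + e_r)^T` and key-query matrix `W = 0` (so attention
weights `(1/2, 1/2)`), the one-layer transformer answers every triple of `D`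
correctly under argmax decoding. -/
theorem one_layer_transformer_memorizes
    (n : ℕ) (hn : 2 ≤ n)
    (S R A : Set (Fin n))
    (hSR : Disjoint S R) (hSA : Disjoint S A) (hRA : Disjoint R A)
    (D : Finset (Fin n × Fin n × Fin n))
    (hD : ∀ s r a, (s, r, a) ∈ D → s ∈ S ∧ r ∈ R ∧ a ∈ A)
    -- (i) each pair (s,r) has at most one answer
    (h1 : ∀ s r a₁ a₂, (s, r, a₁) ∈ D → (s, r, a₂) ∈ D → a₁ = a₂)
    -- (ii) for fixed subject s, distinct triples have distinct answers
    (h2 : ∀ s r₁ a₁ r₂ a₂, (s, r₁, a₁) ∈ D → (s, r₂, a₂) ∈ D → a₁ = a₂ → r₁ = r₂)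
    -- (iii) for fixed relation r, distinct triples have distinct answers
    (h3 : ∀ s₁ s₂ r a₁ a₂, (s₁, r, a₁) ∈ D → (s₂, r, a₂) ∈ D → a₁ = a₂ → s₁ = s₂)
    -- (iv) for (s,r,a) ∈ D, a is the unique token that is simultaneously an answer of
    -- a triple with subject s and an answer of a triple with relation r
    (h4 : ∀ s r a, (s, r, a) ∈ D →
      ∀ a', (∃ r', (s, r', a') ∈ D) → (∃ s', (s', r, a') ∈ D) → a' = a)
    (V : Fin n → Fin n → ℝ)
    (hV : V = fun i j => ∑ t ∈ D, e n t.2.2 i * (e n t.1 + e n t.2.1) j) :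
    ∀ s r a, (s, r, a) ∈ D → ∀ t, t ≠ a →
      ((1 / 2 : ℝ) • mv V (e n s) + (1 / 2 : ℝ) • mv V (e n r)) a >
        ((1 / 2 : ℝ) • mv V (e n s) + (1 / 2 : ℝ) • mv V (e n r)) t := by
  intro s r a hsra t hta
  have hmv : ∀ i j, mv V (e n j) i = V i j := by
    intro i j
    simp [mv, e, Pi.single_apply]
  have hS : ∀ x ∈ D, x.1 ≠ r ∧ x.2.1 ≠ s := by
    rintro ⟨x, y, z⟩ hx
    have hx' := hD _ _ _ hx
    have hs' := hD _ _ _ hsra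
    constructor
    · rintro rfl
      exact Set.disjoint_left.mp hSR hx'.1 hs'.2.1
    · rintro rfl
      exact Set.disjoint_left.mp hSR hs'.1 hx'.2.1
  -- the score of token `i`, as a sum over the triples
  have hsum : ∀ i, V i s + V i r =
      ∑ x ∈ D, (if x.2.2 = i then (1 : ℝ) else 0) *
        ((if x.1 = s then 1 else 0) + (if x.2.1 = r then 1 else 0)) := by
    intro i
    rw [hV]
    simp only
    rw [← Finset.sum_add_distrib]
    refine Finset.sum_congr rfl fun x hx => ?_
    obtain ⟨hx1, hx2⟩ := hS x hx
    simp only [e, Pi.add_apply, Pi.single_apply, eq_comm (a := i), eq_comm (a := s),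
      eq_comm (a := r), hx1, hx2, if_false]
    ring
  have hA : (2 : ℝ) ≤ V a s + V a r := by
    rw [hsum]
    refine le_trans ?_ (Finset.single_le_sum (fun x _ => by positivity) hsra)
    norm_num
  have hT : V t s + V t r ≤ 1 := by
    rw [hsum]
    by_cases hex : ∃ x ∈ D, x.2.2 = t ∧ (x.1 = s ∨ x.2.1 = r)
    · obtain ⟨⟨x, y, z⟩, hx, hz, hxy⟩ := hex
      simp only at hz hxy
      subst hz
      rw [Finset.sum_eq_single_of_mem _ hx]
      · by_cases hxs : x = s
        · have hyr : y ≠ r := by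
            rintro rfl
            subst hxs
            exact hta (h1 _ _ _ _ hx hsra)
          simp [hxs, hyr]
        · simp only [hxs, if_false]
          split_ifs <;> norm_num
      · rintro ⟨x', y', z'⟩ hx' hne
        by_contra hcon
        have hz : z' = z := by
          by_contra h
          simp [h] at hcon
        subst hz
        have hxy' : x' = s ∨ y' = r := by
          by_contra h
          push Not at h
          simp [h.1, h.2] at hcon
        rcases hxy with rfl | rfl <;> rcases hxy' with rfl | rfl
        · exact hne (by rw [h2 _ _ _ _ _ hx hx' rfl])
        · exact hta (h4 _ _ _ hsra _ ⟨_, hx⟩ ⟨_, hx'⟩)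
        · exact hta (h4 _ _ _ hsra _ ⟨_, hx'⟩ ⟨_, hx⟩)
        · exact hne (by rw [h3 _ _ _ _ _ hx hx' rfl])
    · push Not at hex
      rw [Finset.sum_eq_zero]
      · norm_num
      · intro x hx
        by_cases hz : x.2.2 = t
        · obtain ⟨p, q⟩ := hex x hx hz
          simp [p, q]
        · simp [hz]
  simp only [Pi.add_apply, Pi.smul_apply, smul_eq_mul, hmv]
  linarith
end

section
/- Let n ≥ 2, let S, R, A be pairwise disjoint subsets of Fin n, and let D ⊆ S × R × A be a finite set of triples in which each pair (s,r) appears with at most one answer. Let V ∈ ℝ^{n×n} have all entries nonnegative. For each relation r let A^r = {a : (s,r,a) ∈ D for some s}, and let D_min = {(s,r,a) ∈ D : e_a^T V e_r < max_{a' ∈ A^r} e_{a'}^T V e_r} be the triples whose answer does not maximize the relation-marginal score. Then there exists a key-query matrix W ∈ ℝ^{n×n} such that for every (s,r,a) ∈ D_min there is a token ã ≠ a with e_ã^T Z(s,r) > e_a^T Z(s,r), i.e. the one-layer transformer (V, W) answers every triple of D_min incorrectly under argmax decoding. In particular, if D_min is nonempty and the transformer (V, 0) answers every triple of D correctly under argmax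 decoding, then the transformer (V, W) does not achieve 100% argmax decoding accuracy on D even though the value matrix V is unchanged. -/
theorem mv_e_apply {n : ℕ} (V : Fin n → Fin n → ℝ) (r a : Fin n) : mv V (e n r) a = V a r := by
  simp [mv, e, Pi.single_apply]

theorem exists_large_key {n : ℕ} (V : Fin n → Fin n → ℝ) :
    ∃ K : ℝ, ∀ s r a a', V a r < V a' r → V a s - V a' s < Real.exp K * (V a' r - V a r) := by
  have h : ∀ᶠ K : ℝ in Filter.atTop, ∀ s r a a', V a r < V a' r →
      V a s - V a' s < Real.exp K * (V a' r - V a r) := by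
    simp only [Filter.eventually_all]
    intro s r a a' h
    exact (Real.tendsto_exp_atTop.atTop_mul_const (sub_pos.2 h)).eventually_gt_atTop _
  exact h.exists

/-- Attention imbalance can lead to hidden knowledge. There is a key-query
matrix `W` under which every triple of `D_min` (the triples whose answer does not
maximize the relation-marginal score `e_{a'}^T V e_r` over `A^r`) is answered incorrectly
under argmax decoding; in particular, if `D_min ≠ ∅` and `(V, 0)` answers every triple of
`D` correctly, then `(V, W)` does not achieve 100% argmax accuracy on `D`, with the same
value matrix `V`.  (Here `e_a^T V e_r < max_{a' ∈ A^r} e_{a'}^T V e_r` is expressed by the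
equivalent condition `∃ a' ∈ A^r, e_a^T V e_r < e_{a'}^T V e_r`.) -/
theorem attention_imbalance_hidden_knowledge
    (n : ℕ) (hn : 2 ≤ n)
    (S R A : Set (Fin n))
    (hSR : Disjoint S R) (hSA : Disjoint S A) (hRA : Disjoint R A)
    (D : Finset (Fin n × Fin n × Fin n))
    (hD : ∀ s r a, (s, r, a) ∈ D → s ∈ S ∧ r ∈ R ∧ a ∈ A)
    (h1 : ∀ s r a₁ a₂, (s, r, a₁) ∈ D → (s, r, a₂) ∈ D → a₁ = a₂)
    (V : Fin n → Fin n → ℝ) (hVnonneg : ∀ i j, 0 ≤ V i j) :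
    ∃ W : Fin n → Fin n → ℝ,
      (∀ s r a, (s, r, a) ∈ D →
        (∃ a', (∃ s', (s', r, a') ∈ D) ∧ mv V (e n r) a < mv V (e n r) a') →
        ∃ atil, atil ≠ a ∧ Zout V W s r atil > Zout V W s r a) ∧
      ((∃ s r a, (s, r, a) ∈ D ∧
          ∃ a', (∃ s', (s', r, a') ∈ D) ∧ mv V (e n r) a < mv V (e n r) a') →
        (∀ s r a, (s, r, a) ∈ D → ∀ t, t ≠ a → Zout V 0 s r a > Zout V 0 s r t) →
        ¬ (∀ s r a, (s, r, a) ∈ D → ∀ t, t ≠ a → Zout V W s r a > Zout V W s r t)) := by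
  obtain ⟨K, hK⟩ := exists_large_key V
  have key : ∀ s r a, (s, r, a) ∈ D →
      (∃ a', (∃ s', (s', r, a') ∈ D) ∧ mv V (e n r) a < mv V (e n r) a') →
      ∃ atil, atil ≠ a ∧ Zout V (fun i j => if i = j then K else 0) s r atil >
        Zout V (fun i j => if i = j then K else 0) s r a := by
    rintro s r a hd ⟨a', -, hlt⟩
    rw [mv_e_apply, mv_e_apply] at hlt
    have hsr : s ≠ r := by
      rintro rfl
      exact Set.disjoint_left.1 hSR (hD _ _ _ hd).1 (hD _ _ _ hd).2.1
    refine ⟨a', ?_, ?_⟩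
    · rintro rfl
      exact lt_irrefl _ hlt
    · have h := hK s r a a' hlt
      have hp : 0 < 1 + Real.exp K := by positivity
      simp only [Zout, att, softmax, mv_e_apply, Pi.add_apply, Pi.smul_apply, smul_eq_mul,
        Fin.sum_univ_two, Matrix.cons_val_zero, Matrix.cons_val_one, if_neg hsr, if_true,
        Real.exp_zero, gt_iff_lt]
      rw [div_mul_eq_mul_div, div_mul_eq_mul_div, div_mul_eq_mul_div, div_mul_eq_mul_div,
        ← add_div, ← add_div]
      apply div_lt_div_of_pos_right _ hp
      linarith
  refine ⟨_, key, ?_⟩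
  rintro ⟨s, r, a, hd, h⟩ - hall
  obtain ⟨t, ht, hgt⟩ := key s r a hd h
  exact lt_asymm hgt (hall s r a hd t ht)
end

section
/- Let n ≥ 2 and let V ∈ ℝ^{n×n} have all entries nonnegative. Let s, r, a, ã be tokens with d = e_ã^T V e_r − e_a^T V e_r > 0 and fact salience sal = e_a^T V e_s > 0. Let W ∈ ℝ^{n×n} be any key-query matrix with e_r^T W e_r = 0 and e_s^T W e_r < log(d / sal). Then the one-layer transformer (V, W) on input (s,r) satisfies e_a^T Z(s,r) < e_ã^T Z(s,r), so it does not answer a under argmax decoding. (Equivalently: with attention weights (α, β) = σ((c, 0)) for c = e_s^T W e_r, the condition c < log(d/sal) implies α · sal < β · d, which forces the incorrect prediction; thus the more salient the fact, the more negative the attention logit on the subject must be to suppress it.) -/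
/-- If `e_r^T W e_r = 0` and the attention logit on the subject satisfies
`e_s^T W e_r < log(d / sal)` where `d = e_ã^T V e_r − e_a^T V e_r > 0` and the fact
salience `sal = e_a^T V e_s > 0`, then the attention weights `(α, β)` on `(s, r)` satisfy
`α · sal < β · d`, hence `e_a^T Z(s,r) < e_ã^T Z(s,r)` and the transformer does not
answer `a` under argmax decoding. -/
theorem salience_controls_robustness_to_attention_imbalance
    (n : ℕ) (hn : 2 ≤ n)
    (V : Fin n → Fin n → ℝ) (hVnonneg : ∀ i j, 0 ≤ V i j)
    (s r a atil : Fin n)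
    (hd : 0 < mv V (e n r) atil - mv V (e n r) a)
    (hsal : 0 < mv V (e n s) a)
    (W : Fin n → Fin n → ℝ)
    (hWrr : mv W (e n r) r = 0)
    (hWsr : mv W (e n r) s <
      Real.log ((mv V (e n r) atil - mv V (e n r) a) / mv V (e n s) a)) :
    att W s r 0 * mv V (e n s) a < att W s r 1 * (mv V (e n r) atil - mv V (e n r) a) ∧
      Zout V W s r a < Zout V W s r atil ∧
      ¬ (∀ t, t ≠ a → Zout V W s r a > Zout V W s r t) := by
  have hx := (Real.lt_log_iff_exp_lt (div_pos hd hsal)).1 hWsr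
  rw [lt_div_iff₀ hsal] at hx
  have h0 : att W s r 0 = Real.exp (mv W (e n r) s) / (Real.exp (mv W (e n r) s) + 1) := by
    simp [att, softmax, Fin.sum_univ_two, hWrr]
  have h1 : att W s r 1 = 1 / (Real.exp (mv W (e n r) s) + 1) := by
    simp [att, softmax, Fin.sum_univ_two, hWrr]
  have hp : 0 < Real.exp (mv W (e n r) s) + 1 := by positivity
  have hA : 0 ≤ att W s r 0 := by rw [h0]; positivity
  have key : att W s r 0 * mv V (e n s) a <
      att W s r 1 * (mv V (e n r) atil - mv V (e n r) a) := by
    rw [h0, h1, div_mul_eq_mul_div, div_mul_eq_mul_div, one_mul]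
    exact div_lt_div_of_pos_right hx hp
  have hn0 : 0 ≤ mv V (e n s) atil := by
    simpa [mv, e, Pi.single_apply] using hVnonneg atil s
  have hZ : Zout V W s r a < Zout V W s r atil := by
    simp only [Zout, Pi.add_apply, Pi.smul_apply, smul_eq_mul]
    have := mul_nonneg hA hn0
    linarith
  refine ⟨key, hZ, fun h => ?_⟩
  have hne : atil ≠ a := by
    rintro rfl
    exact lt_irrefl _ hZ
  exact lt_asymm hZ (h atil hne)
end

section
/- Let n ≥ 2, let W ∈ ℝ^{n×n}, let s and p be distinct tokens, and let t > 0. Define the updated key-query matrix W' = W + t (e_p e_p^T − e_s e_p^T) (this is the direction of the negative fine-tuning gradient on a fact (s, p, a) when the subject token relevance minus the prompt token relevance is negative). Then for every token s' ≠ p, the attention weight on the subject strictly decreases: σ((e_{s'}^T W' e_p, e_p^T W' e_p))_1 < σ((e_{s'}^T W e_p, e_p^T W e_p))_1, where the subscript 1 denotes the first (subject) component of the two-dimensional softmax. In particular, a single such gradient step globally decreases the attention on every subject token when prompting with (s', p). -/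
/-- A gradient step in the direction `W' = W + t (e_p e_p^T − e_s e_p^T)`
(negative fine-tuning gradient when `s_rel − p_rel < 0`) strictly decreases the attention
weight on the subject token for every prompt `(s', p)` with `s' ≠ p`. -/
theorem nonfactual_gradient_globally_decreases_subject_attention
    (n : ℕ) (hn : 2 ≤ n)
    (W : Fin n → Fin n → ℝ) (s p : Fin n) (hsp : s ≠ p)
    (t : ℝ) (ht : 0 < t)
    (W' : Fin n → Fin n → ℝ)
    (hW' : W' = W + t • (outer (e n p) (e n p) - outer (e n s) (e n p))) :
    ∀ s', s' ≠ p → att W' s' p 0 < att W s' p 0 := by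
  intro s' hs'
  have hmv : ∀ (M : Fin n → Fin n → ℝ) (i : Fin n), mv M (e n p) i = M i p := by
    intro M i
    simp [mv, e, Pi.single_apply]
  have h1 : W' s' p ≤ W s' p := by
    subst hW'
    by_cases h : s' = s
    · subst h
      simp [outer, e, Pi.single_apply, hs', ht.le]
    · simp [outer, e, Pi.single_apply, hs', h]
  have h2 : W p p < W' p p := by
    subst hW'
    simp [outer, e, Pi.single_apply, hsp.symm, ht]
  have e1 := Real.exp_le_exp.mpr h1
  have e2 := Real.exp_lt_exp.mpr h2
  have q1 := Real.exp_pos (W s' p)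
  have q2 := Real.exp_pos (W p p)
  have q3 := Real.exp_pos (W' s' p)
  have q4 := Real.exp_pos (W' p p)
  simp only [att, softmax, hmv, Fin.sum_univ_two, Matrix.cons_val_zero, Matrix.cons_val_one]
  rw [div_lt_div_iff₀ (by positivity) (by positivity)]
  have a1 := mul_le_mul_of_nonneg_right e1 q2.le
  have a2 := mul_lt_mul_of_pos_left e2 q1
  nlinarith
end

section
/- Let n ≥ 2, let W ∈ ℝ^{n×n}, let s and p be distinct tokens, and let t > 0. Define the updated key-query matrix W' = W + t (e_s e_p^T − e_p e_p^T) (this is the direction of the negative fine-tuning gradient on a fact (s, p, a) when the subject token relevance minus the prompt token relevance is positive). Then for every token s' ≠ p, the attention weight on the subject strictly increases: σ((e_{s'}^T W' e_p, e_p^T W' e_p))_1 > σ((e_{s'}^T W e_p, e_p^T W e_p))_1, where the subscript 1 denotes the first (subject) component of the two-dimensional softmax. In particular, a single such gradient step globally increases the attention on every subject token when prompting with (s', p). -/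
/-- A gradient step in the direction `W' = W + t (e_s e_p^T − e_p e_p^T)`
(negative fine-tuning gradient when `s_rel − p_rel > 0`) strictly increases the attention
weight on the subject token for every prompt `(s', p)` with `s' ≠ p`. -/
theorem factual_gradient_globally_increases_subject_attention
    (n : ℕ) (hn : 2 ≤ n)
    (W : Fin n → Fin n → ℝ) (s p : Fin n) (hsp : s ≠ p)
    (t : ℝ) (ht : 0 < t)
    (W' : Fin n → Fin n → ℝ)
    (hW' : W' = W + t • (outer (e n s) (e n p) - outer (e n p) (e n p))) :
    ∀ s', s' ≠ p → att W' s' p 0 > att W s' p 0 := by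
  intro s' hs'
  have key : ∀ (M : Fin n → Fin n → ℝ) (i : Fin n), mv M (e n p) i = M i p := by
    intro M i
    simp [mv, e, Pi.single_apply]
  have h1 : W s' p ≤ W' s' p := by
    have h : 0 ≤ e n s s' := by
      simp only [e, Pi.single_apply]
      split_ifs <;> norm_num
    have h0 : W' s' p = W s' p + t * e n s s' := by
      simp [hW', outer, e, Pi.single_apply, hs']
    rw [h0]
    nlinarith [mul_nonneg ht.le h]
  have h2 : W' p p < W p p := by
    have h0 : W' p p = W p p - t := by
      simp [hW', outer, e, Pi.single_apply, hsp.symm]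
      ring
    linarith
  simp only [att, softmax, key, Fin.sum_univ_two, Matrix.cons_val_zero, Matrix.cons_val_one]
  have e1 := Real.exp_le_exp.mpr h1
  have e2 := Real.exp_lt_exp.mpr h2
  have p1 := Real.exp_pos (W s' p)
  have p2 := Real.exp_pos (W p p)
  have p3 := Real.exp_pos (W' s' p)
  have p4 := Real.exp_pos (W' p p)
  rw [gt_iff_lt, div_lt_div_iff₀ (by positivity) (by positivity)]
  nlinarith [mul_lt_mul_of_pos_left e2 p1, mul_le_mul_of_nonneg_right e1 p2.le]
end

section
/- Fix n ≥ 2, a value matrix V ∈ ℝ^{n×n}, and distinct tokens s, r, a. Define the cross-entropy loss L : ℝ^{n×n} → ℝ by L(W) = −log f(s,r)_a, where f(s,r) = σ(Z(s,r)) is the output of the one-layer transformer with value matrix V and key-query matrix W on input (s,r). Then L is Fréchet differentiable at every W, and its derivative in a direction H ∈ ℝ^{n×n} is DL(W)[H] = Att_s · Att_r · ((f(s,r) − e_a)^T (V e_s − V e_r)) · (e_s^T H e_r − e_r^T H e_r), where (Att_s, Att_r) = σ((e_s^T W e_r, e_r^T W e_r)). Equivalently, the gradient of L with respect to W is Att_s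 Att_r · ((f(s,r) − e_a)^T (V e_s − V e_r)) · (e_s e_r^T − e_r e_r^T), so the negative gradient is proportional to (s_rel − r_rel)(e_s e_r^T − e_r e_r^T), where s_rel = (e_a − f(s,r))^T V e_s and r_rel = (e_a − f(s,r))^T V e_r. -/
theorem mv_e {n : ℕ} (W : Fin n → Fin n → ℝ) (t i : Fin n) : mv W (e n t) i = W i t := by
  simp [mv, e, Pi.single_apply]

theorem att_zero {n : ℕ} (W : Fin n → Fin n → ℝ) (s r : Fin n) :
    att W s r 0 = 1 / (1 + Real.exp (-(W s r - W r r))) := by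
  have h : Real.exp (-(W s r - W r r)) = Real.exp (W r r) / Real.exp (W s r) := by
    rw [← Real.exp_sub]; congr 1; ring
  have h1 := Real.exp_pos (W s r)
  have h2 := Real.exp_pos (W r r)
  simp only [att, softmax, mv_e, Fin.sum_univ_two, Matrix.cons_val_zero, Matrix.cons_val_one]
  rw [h]
  field_simp

theorem att_one {n : ℕ} (W : Fin n → Fin n → ℝ) (s r : Fin n) :
    att W s r 1 = 1 - att W s r 0 := by
  have h1 := Real.exp_pos (W s r)
  have h2 := Real.exp_pos (W r r)
  simp only [att, softmax, mv_e, Fin.sum_univ_two, Matrix.cons_val_zero, Matrix.cons_val_one]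
  field_simp
  ring

theorem hasDerivAt_sigmoid_aux (t : ℝ) :
    HasDerivAt (fun t : ℝ => 1 / (1 + Real.exp (-t)))
      ((1 / (1 + Real.exp (-t))) * (1 - 1 / (1 + Real.exp (-t)))) t := by
  have hp := Real.exp_pos (-t)
  have h : HasDerivAt (fun t : ℝ => 1 + Real.exp (-t)) (Real.exp (-t) * (-1)) t :=
    ((hasDerivAt_id t).neg.exp).const_add 1
  have h2 := (hasDerivAt_const t (1 : ℝ)).div h (by positivity)
  refine h2.congr_deriv ?_
  field_simp
  ring

/-- Loss as a function of the attention weight on `s`. -/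
theorem hasDerivAt_loss_aux {n : ℕ} (p q : Fin n → ℝ) (a : Fin n) (x : ℝ) :
    HasDerivAt (fun x : ℝ => - Real.log (softmax (x • p + (1 - x) • q) a))
      (dot (softmax (x • p + (1 - x) • q) - e n a) (p - q)) x := by
  have hz : ∀ j, HasDerivAt (fun x : ℝ => (x • p + (1 - x) • q) j) (p j - q j) x := by
    intro j
    have h1 : HasDerivAt (fun x : ℝ => x * p j + (1 - x) * q j) (1 * p j + (-1) * q j) x :=
      ((hasDerivAt_id x).mul_const (p j)).add
        (((hasDerivAt_id x).const_sub 1).mul_const (q j))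
    exact h1.congr_deriv (by ring)
  have hpos : ∀ x : ℝ, 0 < ∑ j, Real.exp ((x • p + (1 - x) • q) j) := fun x =>
    Finset.sum_pos (fun j _ => Real.exp_pos _) ⟨a, Finset.mem_univ a⟩
  have hS : HasDerivAt (fun x : ℝ => ∑ j, Real.exp ((x • p + (1 - x) • q) j))
      (∑ j, Real.exp ((x • p + (1 - x) • q) j) * (p j - q j)) x :=
    HasDerivAt.fun_sum fun j _ => (hz j).exp
  have hL := (hS.log (hpos x).ne').sub (hz a)
  have heq : (fun x : ℝ => - Real.log (softmax (x • p + (1 - x) • q) a)) =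
      (fun x : ℝ => Real.log (∑ j, Real.exp ((x • p + (1 - x) • q) j))) -
        fun x : ℝ => (x • p + (1 - x) • q) a := by
    funext y
    rw [Pi.sub_apply]
    unfold softmax
    rw [Real.log_div (Real.exp_pos _).ne' (hpos y).ne', Real.log_exp]
    ring
  rw [heq]
  refine hL.congr_deriv ?_
  simp only [dot, softmax, Pi.sub_apply, sub_mul, Finset.sum_sub_distrib]
  congr 1
  · rw [Finset.sum_div]
    exact Finset.sum_congr rfl fun j _ => by ring
  · simp [e, Pi.single_apply]

/-- The cross-entropy loss `L(W) = −log f(s,r)_a` (as a function of the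
key-query matrix `W`, for fixed value matrix `V`) is Fréchet differentiable at every `W`,
with derivative in direction `H` equal to
`Att_s · Att_r · ((f(s,r) − e_a)^T (V e_s − V e_r)) · (e_s^T H e_r − e_r^T H e_r)`. -/
theorem crossEntropy_fderiv_keyQuery
    (n : ℕ) (hn : 2 ≤ n)
    (V : Fin n → Fin n → ℝ) (s r a : Fin n)
    (hsr : s ≠ r) (hsa : s ≠ a) (hra : r ≠ a)
    (L : (Fin n → Fin n → ℝ) → ℝ)
    (hL : L = fun W => - Real.log (outF V W s r a)) :
    ∀ W : Fin n → Fin n → ℝ,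
      ∃ D : (Fin n → Fin n → ℝ) →L[ℝ] ℝ,
        HasFDerivAt L D W ∧
          ∀ H : Fin n → Fin n → ℝ,
            D H = att W s r 0 * att W s r 1 *
                dot (outF V W s r - e n a) (mv V (e n s) - mv V (e n r)) *
                (mv H (e n r) s - mv H (e n r) r) := by
  intro W
  let T : (Fin n → Fin n → ℝ) →L[ℝ] ℝ :=
    (ContinuousLinearMap.proj (R := ℝ) r).comp
        (ContinuousLinearMap.proj (R := ℝ) (φ := fun _ : Fin n => Fin n → ℝ) s) -
      (ContinuousLinearMap.proj (R := ℝ) r).comp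
        (ContinuousLinearMap.proj (R := ℝ) (φ := fun _ : Fin n => Fin n → ℝ) r)
  have hT : ∀ H, T H = H s r - H r r := fun H => rfl
  have hout : ∀ W, outF V W s r = softmax ((1 / (1 + Real.exp (-(T W)))) • mv V (e n s) +
      (1 - 1 / (1 + Real.exp (-(T W)))) • mv V (e n r)) := by
    intro W
    rw [outF, Zout, att_one, att_zero, hT]
  have hD := ((hasDerivAt_loss_aux (mv V (e n s)) (mv V (e n r)) a
    (1 / (1 + Real.exp (-(T W))))).comp (T W) (hasDerivAt_sigmoid_aux (T W))).comp_hasFDerivAt W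
      T.hasFDerivAt
  refine ⟨_, hD.congr_of_eventuallyEq (Filter.Eventually.of_forall fun W' => ?_), ?_⟩
  · rw [hL]
    simp only [hout, Function.comp_apply]
  · intro H
    rw [hout, att_one, att_zero, mv_e, mv_e, ← hT W, ← hT H]
    simp only [ContinuousLinearMap.smul_apply, smul_eq_mul]
    ring
end

section
/- Let n ≥ 2 be the number of tokens, let ε > 0, C_K > 0, C_V > 0, and let N ∈ ℕ. Consider a sequence of training examples (u_k, v_k, a_k) ∈ (Fin n)³ for k = 0, …, N−1, a sequence of key-query matrices W_k ∈ ℝ^{n×n} with |e_{u_k}^T W_k e_{v_k}| ≤ C_K/2 and |e_{v_k}^T W_k e_{v_k}| ≤ C_K/2 for all k, attention weights (α_k, β_k) = σ((e_{u_k}^T W_k e_{v_k}, e_{v_k}^T W_k e_{v_k})), outputs f_k = σ(α_k V_k e_{u_k} + β_k V_k e_{v_k}), and value matrices defined recursively by V_0 = 0 and V_{k+1} = V_k + ε (α_k (e_{a_k} − f_k) e_{u_k}^T + β_k (e_{a_k} − f_k) e_{v_k}^T) (one SGD step of cross-entropy with learning rate ε per example). Assume ‖V_k e_t‖_∞ ≤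 C_V/2 for all 0 ≤ k ≤ N and all tokens t. Fix distinct tokens t* and a* such that t* ≠ v_k and t* ≠ a_k for all k. Let m = #{k : u_k = t* and a_k = a*} and n_tot = #{k : u_k = t*}. Then after the pass through the data, e_{a*}^T V_N e_{t*} ≥ ε (m · exp(−C_K)/2 − n_tot · exp(C_V)/(n − 1)). -/
theorem aux_mv {n : ℕ} (V : Fin n → Fin n → ℝ) (t i : Fin n) : mv V (e n t) i = V i t := by
  simp [mv, e, Pi.single_apply]

theorem aux_att {n : ℕ} (W : Fin n → Fin n → ℝ) (s r : Fin n) :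
    0 ≤ att W s r 0 ∧ 0 ≤ att W s r 1 ∧ att W s r 0 + att W s r 1 = 1 := by
  simp only [att, softmax, Fin.sum_univ_two, Matrix.cons_val_zero, Matrix.cons_val_one]
  refine ⟨by positivity, by positivity, ?_⟩
  field_simp

theorem aux_att_lb {n : ℕ} (W : Fin n → Fin n → ℝ) (s r : Fin n) (C : ℝ) (hC : 0 < C)
    (h0 : |mv W (e n r) s| ≤ C / 2) (h1 : |mv W (e n r) r| ≤ C / 2) :
    Real.exp (-C) / 2 ≤ att W s r 0 := by
  simp only [att, softmax, Fin.sum_univ_two, Matrix.cons_val_zero, Matrix.cons_val_one]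
  generalize mv W (e n r) s = x at *
  generalize mv W (e n r) r = y at *
  rw [abs_le] at h0 h1
  rw [div_le_div_iff₀ (by norm_num) (by positivity), mul_add, ← Real.exp_add, ← Real.exp_add]
  have a1 : Real.exp (-C + x) ≤ Real.exp x := Real.exp_le_exp.2 (by linarith)
  have a2 : Real.exp (-C + y) ≤ Real.exp x := Real.exp_le_exp.2 (by linarith)
  linarith

theorem aux_softmax {n : ℕ} (hn : 2 ≤ n) (z : Fin n → ℝ) (C : ℝ) (h : ∀ i, |z i| ≤ C / 2)
    (i : Fin n) : 0 ≤ softmax z i ∧ softmax z i ≤ Real.exp C / ((n : ℝ) - 1) := by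
  have hn' : (2 : ℝ) ≤ n := by exact_mod_cast hn
  have hs : (n : ℝ) * Real.exp (-(C / 2)) ≤ ∑ j, Real.exp (z j) := by
    have := Finset.card_nsmul_le_sum Finset.univ (fun j => Real.exp (z j)) (Real.exp (-(C / 2)))
      (fun j _ => Real.exp_le_exp.2 (abs_le.1 (h j)).1)
    simpa using this
  have hpos : 0 < (n : ℝ) * Real.exp (-(C / 2)) := by positivity
  have hS := hpos.trans_le hs
  simp only [softmax]
  refine ⟨by positivity, ?_⟩
  rw [div_le_div_iff₀ hS (by linarith)]
  have e1 : Real.exp (z i) ≤ Real.exp (C / 2) := Real.exp_le_exp.2 (abs_le.1 (h i)).2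
  have e2 : Real.exp C * Real.exp (-(C / 2)) = Real.exp (C / 2) := by
    rw [← Real.exp_add]; congr 1; ring
  calc Real.exp (z i) * ((n : ℝ) - 1) ≤ Real.exp (C / 2) * n :=
        mul_le_mul e1 (by linarith) (by linarith) (Real.exp_pos _).le
    _ = Real.exp C * (n * Real.exp (-(C / 2))) := by rw [← e2]; ring
    _ ≤ _ := mul_le_mul_of_nonneg_left hs (Real.exp_pos _).le

theorem aux_outF {n : ℕ} (hn : 2 ≤ n) (V W : Fin n → Fin n → ℝ) (s r : Fin n) (C : ℝ)
    (h : ∀ t : Fin n, ∀ i, |mv V (e n t) i| ≤ C / 2) (i : Fin n) :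
    0 ≤ outF V W s r i ∧ outF V W s r i ≤ Real.exp C / ((n : ℝ) - 1) := by
  refine aux_softmax hn _ C (fun j => ?_) i
  obtain ⟨h0, h1, h2⟩ := aux_att W s r
  have hs := abs_le.1 (h s j)
  have hr := abs_le.1 (h r j)
  simp only [Zout, Pi.add_apply, Pi.smul_apply, smul_eq_mul]
  have hb : att W s r 1 = 1 - att W s r 0 := by linarith
  rw [hb] at h1 ⊢
  rw [abs_le]
  constructor <;> nlinarith

/-- Token training dynamics. Running one pass of SGD on the value matrix
(cross-entropy, learning rate `ε`, starting from `V₀ = 0`) over examples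
`(u_k, v_k, a_k)`, `k < N`, with bounded attention logits and bounded value-matrix
columns, and with a token `t*` that never occurs as a second (relation) token or as an
answer token, the salience `e_{a*}^T V_N e_{t*}` is lower bounded by
`ε (m · exp(−C_K)/2 − n_tot · exp(C_V)/(n − 1))`, where `m` counts the steps with
`u_k = t*` and `a_k = a*`, and `n_tot` counts the steps with `u_k = t*`. -/
theorem token_training_dynamics_lower_bound
    (n : ℕ) (hn : 2 ≤ n)
    (ε CK CV : ℝ) (hε : 0 < ε) (hCK : 0 < CK) (hCV : 0 < CV)
    (N : ℕ)
    (u v a : ℕ → Fin n)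
    (W : ℕ → Fin n → Fin n → ℝ)
    (hWbnd : ∀ k < N, |mv (W k) (e n (v k)) (u k)| ≤ CK / 2 ∧
      |mv (W k) (e n (v k)) (v k)| ≤ CK / 2)
    (V : ℕ → Fin n → Fin n → ℝ)
    (hV0 : V 0 = 0)
    -- one SGD step of cross-entropy with learning rate ε per example:
    (hVrec : ∀ k < N, V (k + 1) = V k + ε •
      (att (W k) (u k) (v k) 0 •
          outer (e n (a k) - outF (V k) (W k) (u k) (v k)) (e n (u k)) +
        att (W k) (u k) (v k) 1 •
          outer (e n (a k) - outF (V k) (W k) (u k) (v k)) (e n (v k))))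
    (hVbnd : ∀ k ≤ N, ∀ t : Fin n, ∀ i, |mv (V k) (e n t) i| ≤ CV / 2)
    (tstar astar : Fin n) (htsastar : tstar ≠ astar)
    (htv : ∀ k < N, tstar ≠ v k) (hta : ∀ k < N, tstar ≠ a k)
    (m ntot : ℕ)
    (hm : m = ((Finset.range N).filter fun k => u k = tstar ∧ a k = astar).card)
    (hntot : ntot = ((Finset.range N).filter fun k => u k = tstar).card) :
    mv (V N) (e n tstar) astar ≥
      ε * ((m : ℝ) * Real.exp (-CK) / 2 - (ntot : ℝ) * Real.exp CV / ((n : ℝ) - 1)) := by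
  have key : ∀ K ≤ N, ε * ((((Finset.range K).filter fun k => u k = tstar ∧ a k = astar).card : ℝ)
      * (Real.exp (-CK) / 2) - (((Finset.range K).filter fun k => u k = tstar).card : ℝ)
      * (Real.exp CV / ((n : ℝ) - 1))) ≤ V K astar tstar := by
    intro K
    induction K with
    | zero => intro _; simp [hV0]
    | succ k ih =>
      intro hk
      have hkN : k < N := hk
      have ih := ih hkN.le
      obtain ⟨f0, f1⟩ := aux_outF hn (V k) (W k) (u k) (v k) CV (hVbnd k hkN.le) astar
      obtain ⟨h0, h1, h2⟩ := aux_att (W k) (u k) (v k)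
      have hlb := aux_att_lb (W k) (u k) (v k) CK hCK (hWbnd k hkN).1 (hWbnd k hkN).2
      have hv := htv k hkN
      rw [hVrec k hkN]
      simp only [Pi.add_apply, Pi.smul_apply, smul_eq_mul, outer, Pi.sub_apply]
      have ev : e n (v k) tstar = 0 := by simp [e, Pi.single_apply, hv]
      rw [ev, Finset.range_add_one, Finset.filter_insert, Finset.filter_insert]
      generalize outF (V k) (W k) (u k) (v k) astar = f at *
      generalize att (W k) (u k) (v k) 0 = α at *
      generalize Real.exp (-CK) / 2 = p at *
      generalize Real.exp CV / ((n : ℝ) - 1) = q at *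
      have hαf : α * f ≤ q := by nlinarith
      by_cases hu : u k = tstar
      · have eu : e n (u k) tstar = 1 := by simp [e, hu]
        by_cases ha : a k = astar
        · have ea : e n (a k) astar = 1 := by simp [e, ha]
          rw [if_pos ⟨hu, ha⟩, if_pos hu, Finset.card_insert_of_notMem (by simp),
            Finset.card_insert_of_notMem (by simp), ea, eu]
          push_cast
          have := mul_le_mul_of_nonneg_left (show p - q ≤ α * (1 - f) by linarith) hε.le
          linarith
        · have ea : e n (a k) astar = 0 := by simp [e, Pi.single_apply, Ne.symm ha]
          rw [if_neg (fun h => ha h.2), if_pos hu,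
            Finset.card_insert_of_notMem (by simp), ea, eu]
          push_cast
          have := mul_le_mul_of_nonneg_left (show - q ≤ α * (0 - f) by linarith) hε.le
          linarith
      · have eu : e n (u k) tstar = 0 := by simp [e, Pi.single_apply, Ne.symm hu]
        rw [if_neg (fun h => hu h.1), if_neg hu, eu]
        linarith
  have := key N le_rfl
  rw [aux_mv, hm, hntot, ge_iff_le, mul_div_assoc, mul_div_assoc]
  exact this
end
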